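/- Over the alphabet {a, c} (with a ≠ c), the language {w(cw)^k : k ≥ 0, w ∈ {a}*} is not an MCFL; that is, there is no m ∈ ℕ⁺ and no m-MCFG G with L(G) = {w(cw)^k : k ≥ 0, w ∈ {a}*}. -/

import Mathlib

namespace Rewbs

/-- Extended alphabet Δ = Σ ⊎ B ⊎ ℕ⁺ : ordinary characters, brackets `[_i`, `]_i`,
and number characters (references). -/
inductive RSym (A : Type) : Type where
  | ch : A → RSym A
  | open_ : ℕ+ → RSym A
  | close : ℕ+ → RSym A
  | ref : ℕ+ → RSym A

/-- The alphabet Σ ⊎ B (no number characters). -/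
inductive BSym (A : Type) : Type where
  | ch : A → BSym A
  | open_ : ℕ+ → BSym A
  | close : ℕ+ → BSym A

/-- The homomorphism g : (Σ ⊎ B)* → Σ* erasing brackets. -/
def projB {A : Type} (v : List (BSym A)) : List A :=
  v.filterMap fun c => match c with
    | .ch a => some a
    | _ => none

/-- The fetching function fet_i. -/
noncomputable def fet {A : Type} (i : ℕ+) (v : List (BSym A)) : List A :=
  letI : DecidableEq (BSym A) := Classical.decEq _
  if BSym.open_ i ∈ v then
    projB (((v.reverse.takeWhile (fun c => decide (c ≠ BSym.open_ i))).reverse).takeWhile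
      (fun c => decide (c ≠ BSym.close i)))
  else []

/-- One step of the pre-dereferencing function (processing one character, appended
at the right of the already-processed string). -/
noncomputable def derefStep {A : Type} (acc : List (BSym A)) : RSym A → List (BSym A)
  | .ch a => acc ++ [BSym.ch a]
  | .open_ i => acc ++ [BSym.open_ i]
  | .close i => acc ++ [BSym.close i]
  | .ref i => acc ++ (fet i acc).map BSym.ch

/-- The pre-dereferencing function D : Δ* → (Σ ⊎ B)*. -/
noncomputable def preDeref {A : Type} (v : List (RSym A)) : List (BSym A) :=
  v.foldl derefStep []

/-- μ_i = fet_i ∘ D. -/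
noncomputable def mu {A : Type} (i : ℕ+) (v : List (RSym A)) : List A :=
  fet i (preDeref v)

/-- deref = g ∘ D. -/
noncomputable def deref {A : Type} (v : List (RSym A)) : List A :=
  projB (preDeref v)

/-- One step of the `open` function. -/
def openStep {A : Type} (s : Finset ℕ+) : RSym A → Finset ℕ+
  | .open_ i => insert i s
  | .close i => s.erase i
  | _ => s

/-- open : Δ* → finite subsets of ℕ⁺. -/
def openSet {A : Type} (v : List (RSym A)) : Finset ℕ+ :=
  v.foldl openStep ∅

/-- Syntax of regular expressions with backreferences (rewb). -/
inductive Rewb (A : Type) : Type where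
  | ch : A → Rewb A
  | eps : Rewb A
  | backref : ℕ+ → Rewb A
  | cat : Rewb A → Rewb A → Rewb A
  | alt : Rewb A → Rewb A → Rewb A
  | star : Rewb A → Rewb A
  | grp : ℕ+ → Rewb A → Rewb A

/-- `hasIdx i α` : the capturing group `(_i )_i` or the reference `\i` occurs in α. -/
def hasIdx {A : Type} (i : ℕ+) : Rewb A → Prop
  | .ch _ => False
  | .eps => False
  | .backref j => j = i
  | .cat r s => hasIdx i r ∨ hasIdx i s
  | .alt r s => hasIdx i r ∨ hasIdx i s
  | .star r => hasIdx i r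
  | .grp j r => j = i ∨ hasIdx i r

/-- Well-formedness of a rewb: in `(_i α)_i`, the body α contains neither the
capturing group `(_i )_i` nor the reference `\i`. -/
def Rewb.WF {A : Type} : Rewb A → Prop
  | .ch _ => True
  | .eps => True
  | .backref _ => True
  | .cat r s => r.WF ∧ s.WF
  | .alt r s => r.WF ∧ s.WF
  | .star r => r.WF
  | .grp i r => r.WF ∧ ¬ hasIdx i r

/-- The ref-language Ref(α) ⊆ Δ*. -/
def Ref {A : Type} : Rewb A → Language (RSym A)
  | .ch a => {[RSym.ch a]}
  | .eps => 1
  | .backref i => {[RSym.ref i]}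
  | .cat r s => Ref r * Ref s
  | .alt r s => Ref r + Ref s
  | .star r => KStar.kstar (Ref r)
  | .grp i r => ({[RSym.open_ i]} : Language (RSym A)) * Ref r * ({[RSym.close i]} : Language (RSym A))

/-- The language of a rewb: L(α) = deref(Ref(α)). -/
noncomputable def rewbLang {A : Type} (r : Rewb A) : Set (List A) :=
  deref '' (Ref r : Set (List (RSym A)))

/-- capt(α): the set of indices guaranteed to be captured. -/
def capt {A : Type} : Rewb A → Set ℕ+
  | .ch _ => ∅
  | .eps => ∅
  | .backref _ => ∅
  | .cat r s => capt r ∪ capt s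
  | .alt r s => capt r ∩ capt s
  | .star r => capt r
  | .grp i r => capt r ∪ {i}

/-- The relation S ⊢ α. -/
def Sat {A : Type} : Rewb A → Set ℕ+ → Prop
  | .ch _, _ => True
  | .eps, _ => True
  | .backref i, S => i ∈ S
  | .cat r s, S => Sat r S ∧ Sat s (S ∪ capt r)
  | .alt r s, S => Sat r S ∧ Sat s S
  | .star r, S => Sat r S
  | .grp _ r, S => Sat r S

/-- A rewb is closed if ∅ ⊢ α. -/
def Rewb.Closed {A : Type} (r : Rewb A) : Prop := Sat r ∅

/-- A rewb is closed-star if the body of every starred subexpression is closed. -/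
def Rewb.ClosedStar {A : Type} : Rewb A → Prop
  | .ch _ => True
  | .eps => True
  | .backref _ => True
  | .cat r s => r.ClosedStar ∧ s.ClosedStar
  | .alt r s => r.ClosedStar ∧ s.ClosedStar
  | .star r => r.ClosedStar ∧ r.Closed
  | .grp _ r => r.ClosedStar

/-- All indices (number characters and capturing-group indices) occurring in α are ≤ κ. -/
def Rewb.IdxLe {A : Type} (κ : ℕ) : Rewb A → Prop
  | .ch _ => True
  | .eps => True
  | .backref i => (i : ℕ) ≤ κ
  | .cat r s => r.IdxLe κ ∧ s.IdxLe κ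
  | .alt r s => r.IdxLe κ ∧ s.IdxLe κ
  | .star r => r.IdxLe κ
  | .grp i r => (i : ℕ) ≤ κ ∧ r.IdxLe κ

/-- All indices occurring in a character of Δ are ≤ κ. -/
def RSym.idxLe {A : Type} (κ : ℕ) : RSym A → Prop
  | .ch _ => True
  | .open_ i => (i : ℕ) ≤ κ
  | .close i => (i : ℕ) ≤ κ
  | .ref i => (i : ℕ) ≤ κ

/-! ### The tuple functions φ used in the unary-PMCFG construction -/

/-- The ℕ⁺ index corresponding to `j : Fin κ` (memory cell j+1). -/
def toP {κ : ℕ} (j : Fin κ) : ℕ+ := ⟨j.1 + 1, Nat.succ_pos _⟩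

/-- φ_c^M : the input/paste/reset/identity functions on (κ+1)-tuples of strings. -/
def phi {A : Type} (κ : ℕ) (M : Finset ℕ+) :
    RSym A → (List A × (Fin κ → List A)) → (List A × (Fin κ → List A))
  | RSym.ch a, (x, y) => (x ++ [a], fun j => if toP j ∈ M then y j ++ [a] else y j)
  | RSym.ref k, (x, y) =>
      let yk : List A := if h : k.1 ≤ κ ∧ 1 ≤ k.1 then y ⟨k.1 - 1, by omega⟩ else []
      (x ++ yk, fun j => if toP j ∈ M then y j ++ yk else y j)
  | RSym.open_ k, (x, y) => (x, fun j => if toP j = k then [] else y j)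
  | RSym.close _, t => t

/-- Apply the functions φ_{v_r}^{open(prefix·v₁⋯v_r)} successively, left to right,
where `pref` is the already-processed prefix. -/
noncomputable def derefRun {A : Type} (κ : ℕ) :
    List (RSym A) → List (RSym A) → (List A × (Fin κ → List A)) → (List A × (Fin κ → List A))
  | _, [], t => t
  | pref, c :: rest, t => derefRun κ (pref ++ [c]) rest (phi κ (openSet (pref ++ [c])) c t)

/-! ### The quantities t and s -/

/-- One (right-to-left) step of the t-sequence. -/
def tStep {A : Type} (c : RSym A) (t : ℕ+ → ℕ) : ℕ+ → ℕ :=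
  match c with
  | .ch _ => t
  | .close _ => t
  | .open_ j => fun k => if k = j then 0 else t k
  | .ref j => fun k => if k = j then t k + 1 else t k

/-- `tOf suf k` is t_{i,k} where `suf` is the suffix v_{i+1} ⋯ v_m of v. -/
def tOf {A : Type} : List (RSym A) → ℕ+ → ℕ
  | [] => fun _ => 0
  | c :: rest => tStep c (tOf rest)

/-- One (right-to-left) step of the s-sequence; `O` is open(v₁⋯v_i). -/
def sStep {A : Type} (O : Finset ℕ+) (c : RSym A) (s : ℕ+ → ℕ) : ℕ+ → ℕ :=
  match c with
  | .ch _ => s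
  | .close _ => s
  | .open_ j => fun k => if k = j then 0 else s k
  | .ref j => fun k => if k = j then max (max 1 (s j)) (O.sup fun l => s l + 1) else s k

/-- `sOf pref suf k` is s_{i,k} where v = pref ++ suf and i = |pref|. -/
def sOf {A : Type} : List (RSym A) → List (RSym A) → ℕ+ → ℕ
  | _, [] => fun _ => 0
  | pref, c :: rest => sStep (openSet (pref ++ [c])) c (sOf (pref ++ [c]) rest)

/-! ### Parallel multiple context-free grammars -/

/-- An item of an output component of a PMCFG function: a constant string
or the j-th component of the i-th argument. -/
inductive PItem (T : Type) : Type where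
  | const : List T → PItem T
  | arg : ℕ → ℕ → PItem T

/-- A rule A → f[A₁,…,A_l] of a PMCFG, where f is given syntactically by the
lists of items of its output components. -/
structure PRule (T N : Type) : Type where
  lhs : N
  rhs : List N
  out : List (List (PItem T))

/-- A PMCFG with nonterminals `Fin n`. -/
structure PMCFG (T : Type) : Type where
  n : ℕ
  dim : Fin n → ℕ
  start : Fin n
  rules : List (PRule T (Fin n))

/-- Evaluation of a single item, given the tuples derived from the arguments. -/
def evalItem {T : Type} (args : List (List (List T))) : PItem T → List T
  | .const c => c
  | .arg i j => (args.getD i []).getD j []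

/-- Evaluation of one output component. -/
def evalItems {T : Type} (args : List (List (List T))) (items : List (PItem T)) : List T :=
  (items.map (evalItem args)).flatten

/-- The set L_G(A) of tuples derived from each nonterminal. -/
inductive PMCFG.Derives {T : Type} (G : PMCFG T) : Fin G.n → List (List T) → Prop
  | step (r : PRule T (Fin G.n)) (hr : r ∈ G.rules) (args : List (List (List T)))
      (hargs : List.Forall₂ G.Derives r.rhs args) :
      G.Derives r.lhs (r.out.map (evalItems args))

/-- L(G) = L_G(S), identifying 1-tuples with strings. -/
def PMCFG.lang {T : Type} (G : PMCFG T) : Set (List T) :=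
  {w | G.Derives G.start [w]}

/-- Well-formedness of a rule with respect to the dimension assignment. -/
def PRule.WFdim {T N : Type} (dim : N → ℕ) (r : PRule T N) : Prop :=
  r.out.length = dim r.lhs ∧
  ∀ items ∈ r.out, ∀ it ∈ items, ∀ i j, it = PItem.arg i j →
    ∃ h : i < r.rhs.length, j < dim (r.rhs.get ⟨i, h⟩)

/-- G is a well-formed m-PMCFG. -/
def PMCFG.WF {T : Type} (G : PMCFG T) (m : ℕ) : Prop :=
  (∀ A : Fin G.n, 1 ≤ G.dim A ∧ G.dim A ≤ m) ∧ G.dim G.start = 1 ∧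
  ∀ r ∈ G.rules, r.WFdim G.dim

/-- G is unary: every function takes at most one argument. -/
def PMCFG.Unary {T : Type} (G : PMCFG T) : Prop :=
  ∀ r ∈ G.rules, r.rhs.length ≤ 1

/-- The list of argument components referenced by a rule. -/
def PRule.argRefs {T N : Type} (r : PRule T N) : List (ℕ × ℕ) :=
  r.out.flatten.filterMap fun it => match it with
    | .arg i j => some (i, j)
    | _ => none

/-- G is an MCFG: no rule uses the same argument component more than once. -/
def PMCFG.NonDup {T : Type} (G : PMCFG T) : Prop :=
  ∀ r ∈ G.rules, r.argRefs.Nodup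

/-! ### Stack automata -/

/-- Direction of the stack pointer. -/
inductive SDir : Type where
  | left | stay | right
deriving DecidableEq

/-- A one-way nondeterministic stack automaton.  The input symbol `none`
denotes the endmarker ▷.  `push q a Z` is the pushdown mode (applicable when the
stack pointer is at the top symbol Z; the Bool is whether the input head moves
right); `read q a Z top` is the stack-reading mode (`top` tells whether the
pointed symbol Z is the topmost one). -/
structure SA (T : Type) : Type 1 where
  Q : Type
  finQ : Fintype Q
  Γ : Type
  finΓ : Fintype Γ
  q0 : Q
  Z0 : Γ
  F : Set Q
  push : Q → Option T → Γ → Set (Q × Bool × List Γ)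
  read : Q → Option T → Γ → Bool → Set (Q × Bool × SDir)

namespace SA

/-- Instantaneous description: state, remaining input (the endmarker ▷ is
implicit at the end), stack below-and-including the pointer, stack above the
pointer. -/
def Conf {T : Type} (M : SA T) : Type := M.Q × List T × List M.Γ × List M.Γ

/-- Move the stack pointer: the stack is γ ++ [Z] ++ above with the pointer on Z. -/
def moveStack {Γ : Type} : SDir → List Γ → Γ → List Γ → List Γ × List Γ
  | .left, γ, Z, above => (γ, Z :: above)
  | .stay, γ, Z, above => (γ ++ [Z], above)
  | .right, γ, Z, b :: rest => (γ ++ [Z, b], rest)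
  | .right, γ, Z, [] => (γ ++ [Z], [])

/-- One move of a stack automaton on instantaneous descriptions. -/
inductive Step {T : Type} (M : SA T) : M.Conf → M.Conf → Prop
  | push (q : M.Q) (u : List T) (γ : List M.Γ) (Z : M.Γ) (q' : M.Q) (d : Bool) (y : List M.Γ)
      (hmem : (q', d, y) ∈ M.push q u.head? Z)
      (hd : d = true → u ≠ []) :
      Step M (q, u, γ ++ [Z], []) (q', if d then u.tail else u, γ ++ y, [])
  | read (q : M.Q) (u : List T) (γ : List M.Γ) (Z : M.Γ) (above : List M.Γ)
      (q' : M.Q) (d : Bool) (e : SDir)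
      (hmem : (q', d, e) ∈ M.read q u.head? Z above.isEmpty)
      (hd : d = true → u ≠ [])
      (hleft : e = SDir.left → γ ≠ [])
      (hright : e = SDir.right → above ≠ []) :
      Step M (q, u, γ ++ [Z], above)
        (q', if d then u.tail else u, (moveStack e γ Z above).1, (moveStack e γ Z above).2)

/-- Acceptance: from (q₀, w▷, Z₀↑$) reach a final state with the whole input read. -/
def Accepts {T : Type} (M : SA T) (w : List T) : Prop :=
  ∃ (qf : M.Q) (g1 g2 : List M.Γ), qf ∈ M.F ∧
    Relation.ReflTransGen (Step M) (M.q0, w, [M.Z0], []) (qf, [], g1, g2)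

/-- The language of a stack automaton. -/
def lang {T : Type} (M : SA T) : Set (List T) := {w | M.Accepts w}

/-- Nonerasing: every pushdown-mode transition pushes a nonempty word. -/
def NonErasing {T : Type} (M : SA T) : Prop :=
  ∀ q a Z q' d y, (q', d, y) ∈ M.push q a Z → y ≠ []

end SA

/-! ### Commutative grammars over `ℕ × ℕ` -/

/-- A production of a commutative grammar: `lhs` rewrites to the vector `c` plus a
family of nonterminals. -/
structure CRule (V : Type) : Type where
  lhs : V
  c : ℕ × ℕ
  k : ℕ
  rhs : Fin k → V

/-- The vectors derived from each nonterminal of a commutative grammar. -/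
inductive CDerives {V : Type} (R : Set (CRule V)) : V → ℕ × ℕ → Prop
  | step (r : CRule V) (hr : r ∈ R) (v : Fin r.k → ℕ × ℕ)
      (hv : ∀ i, CDerives R (r.rhs i) (v i)) : CDerives R r.lhs (r.c + ∑ i, v i)

/-- Vectors derived by a tree in which all nonterminals lie in `S` and no nonterminal is
repeated along a path. -/
inductive CSimple {V : Type} [DecidableEq V] (R : Set (CRule V)) :
    Finset V → V → ℕ × ℕ → Prop
  | step (S : Finset V) (r : CRule V) (hr : r ∈ R) (hS : r.lhs ∈ S) (v : Fin r.k → ℕ × ℕ)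
      (hv : ∀ i, CSimple R (S.erase r.lhs) (r.rhs i) (v i)) :
      CSimple R S r.lhs (r.c + ∑ i, v i)

section Commutative

variable {V : Type} {R : Set (CRule V)}

theorem CSimple.derives [DecidableEq V] {S : Finset V} {X : V} {v : ℕ × ℕ}
    (h : CSimple R S X v) : CDerives R X v := by
  induction h with
  | step S r hr hS v hv ih => exact .step r hr v ih

theorem CSimple.mono [DecidableEq V] {S S' : Finset V} {X : V} {v : ℕ × ℕ}
    (h : CSimple R S X v) (hS : S ⊆ S') : CSimple R S' X v := by
  induction h generalizing S' with
  | step S r hr hX v hv ih =>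
    exact .step S' r hr (hS hX) v fun i => ih i (Finset.erase_subset_erase _ hS)

theorem sum_size_le {k : ℕ} (v : Fin k → ℕ × ℕ) (B K : ℕ) (hk : k ≤ K)
    (hv : ∀ i, (v i).1 + (v i).2 ≤ B) : (∑ i, v i).1 + (∑ i, v i).2 ≤ K * B := by
  rw [Prod.fst_sum, Prod.snd_sum, ← Finset.sum_add_distrib]
  calc ∑ i, ((v i).1 + (v i).2) ≤ ∑ _i : Fin k, B := Finset.sum_le_sum fun i _ => hv i
    _ = k * B := by simp
    _ ≤ K * B := Nat.mul_le_mul_right _ hk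

theorem CSimple.bounded [DecidableEq V] {C K : ℕ}
    (hC : ∀ r ∈ R, r.c.1 + r.c.2 ≤ C) (hK : ∀ r ∈ R, r.k ≤ K) (n : ℕ) :
    ∃ B, ∀ S : Finset V, S.card ≤ n → ∀ X v, CSimple R S X v → v.1 + v.2 ≤ B := by
  induction n with
  | zero =>
    refine ⟨0, fun S hS X v h => ?_⟩
    cases h with
    | step _ r hr hX v hv => simp_all
  | succ n ih =>
    obtain ⟨B, hB⟩ := ih
    refine ⟨C + K * B, fun S hS X v h => ?_⟩
    cases h with
    | step _ r hr hX v hv =>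
      have hcard : (S.erase r.lhs).card ≤ n := by
        rw [Finset.card_erase_of_mem hX]; omega
      have h1 := sum_size_le v B K (hK r hr) fun i => hB _ hcard _ _ (hv i)
      have h2 := hC r hr
      simp only [Prod.fst_add, Prod.snd_add]
      omega

/-- Replacing one summand in the body of a production. -/
theorem CDerives.step_update {r : CRule V} (hr : r ∈ R) {v : Fin r.k → ℕ × ℕ}
    (hv : ∀ i, CDerives R (r.rhs i) (v i)) (i : Fin r.k) {u : ℕ × ℕ}
    (hu : CDerives R (r.rhs i) u) :
    CDerives R r.lhs (u + (r.c + ∑ j ∈ Finset.univ.erase i, v j)) := by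
  have h := CDerives.step r hr (Function.update v i u) fun j => by
    by_cases hj : j = i
    · subst hj; simpa using hu
    · simpa [hj] using hv j
  have e : r.c + ∑ j, Function.update v i u j
      = u + (r.c + ∑ j ∈ Finset.univ.erase i, v j) := by
    rw [← Finset.add_sum_erase Finset.univ (Function.update v i u) (Finset.mem_univ i),
      Function.update_self,
      Finset.sum_congr rfl fun j hj =>
        Function.update_of_ne (Finset.ne_of_mem_erase hj) _ _]
    abel
  rwa [e] at h

theorem CRule.sum_eq (r : CRule V) (v : Fin r.k → ℕ × ℕ) (i : Fin r.k) :
    r.c + ∑ j, v j = v i + (r.c + ∑ j ∈ Finset.univ.erase i, v j) := by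
  rw [← Finset.add_sum_erase _ _ (Finset.mem_univ i)]
  abel

/-- A simple derivation either avoids `X` or factors through a simple derivation from `X`. -/
theorem CSimple.avoid_or_factor [DecidableEq V] {S : Finset V} {Y : V} {v : ℕ × ℕ}
    (h : CSimple R S Y v) (X : V) :
    CSimple R (S.erase X) Y v ∨
      ∃ v' p, v = v' + p ∧ CSimple R S X v' ∧
        ∀ u, CDerives R X u → CDerives R Y (u + p) := by
  induction h with
  | step S r hr hS v hv ih =>
    by_cases hX : r.lhs = X
    · refine Or.inr ⟨_, 0, (add_zero _).symm, hX ▸ .step S r hr hS v hv, fun u hu => ?_⟩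
      rw [add_zero, hX]
      exact hu
    by_cases hall : ∀ i, CSimple R ((S.erase r.lhs).erase X) (r.rhs i) (v i)
    · refine Or.inl (.step _ r hr (Finset.mem_erase.2 ⟨hX, hS⟩) v fun i => ?_)
      rw [Finset.erase_right_comm]
      exact hall i
    · push Not at hall
      obtain ⟨i, hi⟩ := hall
      obtain ⟨v', p, e, hs, hp⟩ := (ih i).resolve_left hi
      refine Or.inr ⟨v', p + (r.c + ∑ j ∈ Finset.univ.erase i, v j), ?_,
        hs.mono (Finset.erase_subset _ _), fun u hu => ?_⟩
      · rw [r.sum_eq v i, e, add_assoc]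
      · rw [← add_assoc]
        exact CDerives.step_update hr (fun j => (hv j).derives) i (hp u hu)

/-- Pumping lemma for commutative grammars. -/
theorem CDerives.pumping [Finite V] (hR : R.Finite) :
    ∃ B : ℕ, ∀ X v, CDerives R X v → v.1 + v.2 ≤ B ∨
      ∃ p : ℕ × ℕ, p ≠ 0 ∧ p.1 + p.2 ≤ B ∧ ∀ i : ℕ, CDerives R X (v + i • p) := by
  classical
  have := Fintype.ofFinite V
  obtain ⟨C, hC⟩ := (hR.image fun r => r.c.1 + r.c.2).bddAbove
  obtain ⟨K, hK⟩ := (hR.image fun r => r.k).bddAbove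
  replace hC : ∀ r ∈ R, r.c.1 + r.c.2 ≤ C := fun r hr => hC ⟨r, hr, rfl⟩
  replace hK : ∀ r ∈ R, r.k ≤ K := fun r hr => hK ⟨r, hr, rfl⟩
  obtain ⟨B₀, hB₀⟩ := CSimple.bounded hC hK (Fintype.card V)
  replace hB₀ : ∀ X v, CSimple R Finset.univ X v → v.1 + v.2 ≤ B₀ :=
    hB₀ Finset.univ le_rfl
  suffices h : ∀ X v, CDerives R X v → CSimple R Finset.univ X v ∨
      ∃ p : ℕ × ℕ, p ≠ 0 ∧ p.1 + p.2 ≤ C + K * B₀ ∧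
        ∀ i : ℕ, CDerives R X (v + i • p) by
    refine ⟨B₀ + (C + K * B₀), fun X v hv => ?_⟩
    rcases h X v hv with hs | ⟨p, hp, hle, hd⟩
    · exact Or.inl ((hB₀ X v hs).trans (Nat.le_add_right _ _))
    · exact Or.inr ⟨p, hp, hle.trans (Nat.le_add_left _ _), hd⟩
  intro X v h
  induction h with
  | step r hr v hv ih =>
    by_cases hall : ∀ i, CSimple R Finset.univ (r.rhs i) (v i)
    · by_cases hav : ∀ i, CSimple R (Finset.univ.erase r.lhs) (r.rhs i) (v i)
      · exact Or.inl (.step _ r hr (Finset.mem_univ _) v hav)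
      · push Not at hav
        obtain ⟨i, hi⟩ := hav
        obtain ⟨v', p, e, hs, hp⟩ := ((hall i).avoid_or_factor r.lhs).resolve_left hi
        have htot : r.c + ∑ j, v j = v' + (p + (r.c + ∑ j ∈ Finset.univ.erase i, v j)) := by
          rw [r.sum_eq v i, e, add_assoc]
        have hpump : ∀ u, CDerives R r.lhs u →
            CDerives R r.lhs (u + (p + (r.c + ∑ j ∈ Finset.univ.erase i, v j))) := by
          intro u hu
          rw [← add_assoc]
          exact CDerives.step_update hr hv i (hp u hu)
        generalize p + (r.c + ∑ j ∈ Finset.univ.erase i, v j) = q at htot hpump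
        by_cases hq : q = 0
        · left
          rw [htot, hq, add_zero]
          exact hs
        · refine Or.inr ⟨q, hq, ?_, fun n => ?_⟩
          · have h1 := sum_size_le v B₀ K (hK r hr) fun i => hB₀ _ _ (hall i)
            have h2 := hC r hr
            have h3 := congrArg Prod.fst htot
            have h4 := congrArg Prod.snd htot
            simp only [Prod.fst_add, Prod.snd_add] at h3 h4
            omega
          · induction n with
            | zero =>
              rw [zero_smul, add_zero]
              exact .step r hr v hv
            | succ n ihn =>
              rw [succ_nsmul, ← add_assoc]
              exact hpump _ ihn
    · push Not at hall
      obtain ⟨i, hi⟩ := hall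
      obtain ⟨p, hp, hle, hd⟩ := (ih i).resolve_left hi
      refine Or.inr ⟨p, hp, hle, fun n => ?_⟩
      have h := CDerives.step_update hr hv i (hd n)
      rwa [add_right_comm, ← r.sum_eq v i] at h

end Commutative

/-! ### The commutative grammar of an MCFG -/

section Parikh

variable {T : Type}

open Classical in
/-- The numbers of occurrences of two letters in a word. -/
noncomputable def parikh (a c : T) (w : List T) : ℕ × ℕ := (w.count a, w.count c)

theorem parikh_nil (a c : T) : parikh a c [] = 0 := by
  simp [parikh]

theorem parikh_append (a c : T) (u v : List T) :
    parikh a c (u ++ v) = parikh a c u + parikh a c v := by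
  simp [parikh]

/-- Total Parikh vector of the components of a tuple selected by `M`. -/
noncomputable def selParikh {m : ℕ} (a c : T) (M : Finset (Fin m)) (t : List (List T)) : ℕ × ℕ :=
  ∑ j ∈ M, parikh a c (t.getD j [])

/-- The argument components occurring in a list of items. -/
def itemRefs (items : List (PItem T)) : List (ℕ × ℕ) :=
  items.filterMap fun it => match it with
    | .arg i j => some (i, j)
    | _ => none

/-- The Parikh vector of the constants occurring in a list of items. -/
noncomputable def constParikh (a c : T) : List (PItem T) → ℕ × ℕ
  | [] => 0
  | .const w :: items => parikh a c w + constParikh a c items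
  | .arg _ _ :: items => constParikh a c items

theorem evalItems_nil (args : List (List (List T))) : evalItems args [] = [] := rfl

theorem evalItems_cons (args : List (List (List T))) (it : PItem T) (items : List (PItem T)) :
    evalItems args (it :: items) = evalItem args it ++ evalItems args items := rfl

theorem parikh_evalItems (a c : T) (args : List (List (List T))) (items : List (PItem T)) :
    parikh a c (evalItems args items) = constParikh a c items +
      ((itemRefs items).map fun x => parikh a c ((args.getD x.1 []).getD x.2 [])).sum := by
  induction items with
  | nil => simp [evalItems_nil, constParikh, itemRefs, parikh_nil]
  | cons it items ih =>
    rw [evalItems_cons, parikh_append, ih]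
    cases it with
    | const w => simp [constParikh, itemRefs, evalItem, add_assoc]
    | arg i j =>
      simp only [constParikh, itemRefs, evalItem, List.filterMap_cons, List.map_cons,
        List.sum_cons]
      abel

theorem sum_map_eq_sum_count {l m : ℕ} (g : ℕ × ℕ → ℕ × ℕ) (refs : List (ℕ × ℕ))
    (h : ∀ x ∈ refs, x.1 < l ∧ x.2 < m) :
    (refs.map g).sum =
      ∑ i : Fin l, ∑ j : Fin m, refs.count ((i : ℕ), (j : ℕ)) • g (i, j) := by
  induction refs with
  | nil => simp
  | cons x refs ih =>
    obtain ⟨hx1, hx2⟩ := h x List.mem_cons_self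
    rw [List.map_cons, List.sum_cons, ih fun y hy => h y (List.mem_cons_of_mem _ hy)]
    have hsingle : g x = ∑ i : Fin l, ∑ j : Fin m,
        (if x = ((i : ℕ), (j : ℕ)) then 1 else 0) • g (i, j) := by
      rw [Finset.sum_eq_single (⟨x.1, hx1⟩ : Fin l), Finset.sum_eq_single (⟨x.2, hx2⟩ : Fin m)]
      · simp
      · intro j _ hj
        rw [if_neg, zero_smul]
        exact fun e => hj (Fin.ext (congrArg Prod.snd e).symm)
      · simp
      · intro i _ hi
        refine Finset.sum_eq_zero fun j _ => ?_
        rw [if_neg, zero_smul]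
        exact fun e => hi (Fin.ext (congrArg Prod.fst e).symm)
      · simp
    rw [hsingle]
    simp only [← Finset.sum_add_distrib, ← add_smul, List.count_cons, beq_iff_eq, add_comm]

theorem sum_count_itemRefs_getD (out : List (List (PItem T))) (x : ℕ × ℕ) (m : ℕ)
    (h : out.length ≤ m) :
    ∑ J : Fin m, (itemRefs (out.getD J [])).count x = (itemRefs out.flatten).count x := by
  induction out generalizing m with
  | nil => simp [itemRefs]
  | cons l out ih =>
    obtain _ | m := m
    · simp at h
    · rw [Fin.sum_univ_succ]
      simp only [Fin.val_zero, List.getD_cons_zero, Fin.val_succ, List.getD_cons_succ]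
      rw [ih m (by simpa using h)]
      simp [itemRefs, List.filterMap_append]

open Classical in
/-- The components of the `i`-th argument used by the output components in `M`. -/
noncomputable def usedComponents {N : Type} {m : ℕ} (r : PRule T N) (M : Finset (Fin m))
    (i : ℕ) : Finset (Fin m) :=
  Finset.univ.filter fun j => ∃ J ∈ M, (i, (j : ℕ)) ∈ itemRefs (r.out.getD J [])

theorem sum_count_eq_ite {N : Type} {m : ℕ} (r : PRule T N) (hnd : r.argRefs.Nodup)
    (hlen : r.out.length ≤ m) (M : Finset (Fin m)) (i : ℕ) (j : Fin m) :
    ∑ J ∈ M, (itemRefs (r.out.getD J [])).count (i, (j : ℕ)) =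
      if j ∈ usedComponents r M i then 1 else 0 := by
  have hle : ∑ J ∈ M, (itemRefs (r.out.getD J [])).count (i, (j : ℕ)) ≤ 1 := by
    refine (Finset.sum_le_sum_of_subset (Finset.subset_univ M)).trans ?_
    rw [sum_count_itemRefs_getD _ _ _ hlen]
    exact List.nodup_iff_count_le_one.1 hnd _
  split_ifs with h
  · refine le_antisymm hle ?_
    simp only [usedComponents, Finset.mem_filter, Finset.mem_univ, true_and] at h
    obtain ⟨J, hJ, hmem⟩ := h
    exact (List.count_pos_iff.2 hmem).trans_le (Finset.single_le_sum
      (f := fun J : Fin m => (itemRefs (r.out.getD J [])).count (i, (j : ℕ)))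
      (fun _ _ => Nat.zero_le _) hJ)
  · refine Finset.sum_eq_zero fun J hJ => List.count_eq_zero.2 fun hmem => h ?_
    simp only [usedComponents, Finset.mem_filter, Finset.mem_univ, true_and]
    exact ⟨J, hJ, hmem⟩

/-- The commutative production obtained from a rule and a set of output components. -/
noncomputable def PRule.toCRule {N : Type} {m : ℕ} (a c : T) (r : PRule T N)
    (M : Finset (Fin m)) : CRule (N × Finset (Fin m)) where
  lhs := (r.lhs, M)
  c := ∑ J ∈ M, constParikh a c (r.out.getD J [])
  k := r.rhs.length
  rhs i := (r.rhs.get i, usedComponents r M i)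

theorem PRule.selParikh_eval {N : Type} {m : ℕ} (a c : T) {dim : N → ℕ} (r : PRule T N)
    (hdim : ∀ A, dim A ≤ m) (hwf : r.WFdim dim) (hnd : r.argRefs.Nodup)
    (M : Finset (Fin m)) (args : List (List (List T))) :
    selParikh a c M (r.out.map (evalItems args)) = (r.toCRule a c M).c +
      ∑ i : Fin r.rhs.length, selParikh a c (usedComponents r M i) (args.getD i []) := by
  have hlen : r.out.length ≤ m := hwf.1.trans_le (hdim _)
  have hrefs : ∀ J : ℕ, ∀ x ∈ itemRefs (r.out.getD J []), x.1 < r.rhs.length ∧ x.2 < m := by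
    intro J x hx
    by_cases hJ : J < r.out.length
    · rw [List.getD_eq_getElem _ _ hJ] at hx
      obtain ⟨it, hit, he⟩ := List.mem_filterMap.1 hx
      cases it with
      | const w => simp at he
      | arg i j =>
        simp only [Option.some.injEq] at he
        subst he
        obtain ⟨h1, h2⟩ := hwf.2 _ (List.getElem_mem hJ) _ hit i j rfl
        exact ⟨h1, h2.trans_le (hdim _)⟩
    · rw [List.getD_eq_default _ _ (not_lt.1 hJ)] at hx
      simp [itemRefs] at hx
  have hget : ∀ J : ℕ, (r.out.map (evalItems args)).getD J [] =
      evalItems args (r.out.getD J []) := fun _ =>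
    List.getD_map (l := r.out) [] (evalItems args)
  simp only [selParikh, hget, parikh_evalItems, Finset.sum_add_distrib, PRule.toCRule]
  congr 1
  rw [Finset.sum_congr rfl fun (J : Fin m) _ => sum_map_eq_sum_count _ _ (hrefs J),
    Finset.sum_comm]
  refine Finset.sum_congr rfl fun i _ => ?_
  rw [Finset.sum_comm]
  simp only [← Finset.sum_smul, sum_count_eq_ite r hnd hlen, ite_smul, one_smul, zero_smul,
    Finset.sum_ite_mem, Finset.univ_inter]

/-- The commutative grammar of `G`; its nonterminals are those of `G` together with a
set of selected components. -/
noncomputable def PMCFG.cRules (G : PMCFG T) (m : ℕ) (a c : T) :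
    Set (CRule (Fin G.n × Finset (Fin m))) :=
  {R | ∃ r ∈ G.rules, ∃ M, r.toCRule a c M = R}

theorem PMCFG.finite_cRules (G : PMCFG T) (m : ℕ) (a c : T) : (G.cRules m a c).Finite := by
  refine ((G.rules.finite_toSet.prod (Set.finite_univ (α := Finset (Fin m)))).image
    fun x => x.1.toCRule a c x.2).subset ?_
  rintro _ ⟨r, hr, M, rfl⟩
  exact ⟨(r, M), ⟨hr, trivial⟩, rfl⟩

theorem PMCFG.Derives.cDerives {G : PMCFG T} {m : ℕ} (a c : T) (hwf : G.WF m) (hnd : G.NonDup)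
    {A : Fin G.n} {t : List (List T)} (h : G.Derives A t) (M : Finset (Fin m)) :
    CDerives (G.cRules m a c) (A, M) (selParikh a c M t) := by
  revert M
  refine PMCFG.Derives.rec (G := G)
    (motive_1 := fun A t _ => ∀ M : Finset (Fin m),
      CDerives (G.cRules m a c) (A, M) (selParikh a c M t))
    (motive_2 := fun l ts _ => List.Forall₂ (fun A t => ∀ M : Finset (Fin m),
      CDerives (G.cRules m a c) (A, M) (selParikh a c M t)) l ts)
    ?_ .nil (fun _ _ h1 h2 => .cons h1 h2) h
  intro r hr args _ ih M
  rw [r.selParikh_eval a c (fun A => (hwf.1 A).2) (hwf.2.2 r hr) (hnd r hr)]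
  refine CDerives.step (R := G.cRules m a c) (r.toCRule a c M) ⟨r, hr, M, rfl⟩
    (fun i => selParikh a c (usedComponents r M i) (args.getD i [])) fun i => ?_
  have hi : (i : ℕ) < args.length := ih.length_eq ▸ i.2
  have := ih.get i.2 hi (usedComponents r M i)
  rw [List.getD_eq_getElem _ _ hi]
  exact this

theorem PMCFG.exists_derives_of_cDerives {G : PMCFG T} {m : ℕ} {a c : T} (hwf : G.WF m)
    (hnd : G.NonDup) {X : Fin G.n × Finset (Fin m)} {v : ℕ × ℕ}
    (h : CDerives (G.cRules m a c) X v) :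
    ∃ t, G.Derives X.1 t ∧ selParikh a c X.2 t = v := by
  induction h with
  | step R hR v hv ih =>
    obtain ⟨r, hr, M, rfl⟩ := hR
    choose t ht htv using ih
    refine ⟨r.out.map (evalItems (List.ofFn t)), .step r hr _ ?_, ?_⟩
    · refine List.forall₂_iff_get.2 ⟨(List.length_ofFn (f := t)).symm, fun i h1 h2 => ?_⟩
      rw [List.get_ofFn]
      exact ht ⟨i, h1⟩
    · refine (r.selParikh_eval a c (fun A => (hwf.1 A).2) (hwf.2.2 r hr) (hnd r hr) M _).trans ?_
      congr 1
      refine Finset.sum_congr rfl fun i _ => ?_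
      have hi : (i : ℕ) < (List.ofFn t).length := by
        rw [List.length_ofFn]; exact i.2
      rw [List.getD_eq_getElem _ _ hi, List.getElem_ofFn]
      exact htv i

/-- Pumping lemma for the Parikh images of multiple context-free languages. -/
theorem PMCFG.exists_parikh_pumping {G : PMCFG T} {m : ℕ} (hm : 1 ≤ m) (hwf : G.WF m)
    (hnd : G.NonDup) (a c : T) :
    ∃ B : ℕ, ∀ w ∈ G.lang, (parikh a c w).1 + (parikh a c w).2 ≤ B ∨
      ∃ p : ℕ × ℕ, p ≠ 0 ∧ p.1 + p.2 ≤ B ∧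
        ∀ i : ℕ, ∃ w' ∈ G.lang, parikh a c w' = parikh a c w + i • p := by
  obtain ⟨B, hB⟩ := CDerives.pumping (G.finite_cRules m a c)
  have hsel : ∀ w : List T, selParikh a c {(⟨0, hm⟩ : Fin m)} [w] = parikh a c w := by
    simp [selParikh]
  refine ⟨B, fun w hw => ?_⟩
  have hd := PMCFG.Derives.cDerives a c hwf hnd hw {(⟨0, hm⟩ : Fin m)}
  rw [hsel] at hd
  refine (hB _ _ hd).imp_right ?_
  rintro ⟨p, hp, hle, hpump⟩
  refine ⟨p, hp, hle, fun i => ?_⟩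
  obtain ⟨t, ht, htv⟩ := PMCFG.exists_derives_of_cDerives hwf hnd (hpump i)
  have hlen : t.length = 1 := by
    rw [← hwf.2.1]
    generalize hA : G.start = A at ht
    cases ht with
    | step r hr args hargs =>
      rw [List.length_map]
      exact (hwf.2.2 r hr).1
  obtain ⟨w', rfl⟩ := List.length_eq_one_iff.1 hlen
  exact ⟨w', ht, (hsel w').symm.trans htv⟩

theorem parikh_blocks {a c : T} (hac : a ≠ c) (k n : ℕ) :
    parikh a c (List.replicate n a ++ (List.replicate k (c :: List.replicate n a)).flatten) =
      (n * (k + 1), k) := by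
  induction k with
  | zero => simp [parikh, List.count_replicate, hac]
  | succ k ih =>
    rw [parikh, Prod.mk.injEq] at ih ⊢
    simp only [List.replicate_succ, List.flatten_cons, List.count_append, List.count_cons,
      List.count_replicate, beq_self_eq_true, beq_iff_eq, hac, hac.symm, if_true, if_false] at ih ⊢
    constructor
    · linarith [ih.1]
    · linarith [ih.2]

end Parikh

/-- No short nonzero vector pumps `(N * (N + 1), N)` within the vectors `(n * (k + 1), k)`. -/
theorem eq_zero_of_pump_blocks {N : ℕ} {p : ℕ × ℕ} (hp : p.1 + p.2 < N)
    (h : ∀ i : ℕ, ∃ k n : ℕ, (n * (k + 1), k) = (N * (N + 1), N) + i • p) : p = 0 := by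
  obtain ⟨x, y⟩ := p
  replace h : ∀ i : ℕ, ∃ n : ℕ, n * (N + i * y + 1) = N * (N + 1) + i * x := by
    intro i
    obtain ⟨k, n, e⟩ := h i
    simp only [Prod.smul_mk, smul_eq_mul, Prod.mk_add_mk, Prod.mk.injEq] at e
    obtain ⟨e1, rfl⟩ := e
    exact ⟨n, e1⟩
  simp only at hp
  obtain rfl | hy := Nat.eq_zero_or_pos y
  · obtain ⟨n, hn⟩ := h 1
    have hdvd : N + 1 ∣ x := by
      have h1 : N + 1 ∣ N * (N + 1) + 1 * x := ⟨n, by rw [← hn]; ring⟩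
      simpa using (Nat.dvd_add_right (Dvd.intro_left N rfl)).1 h1
    rw [Nat.eq_zero_of_dvd_of_lt hdvd (by omega)]
    rfl
  · exfalso
    obtain ⟨d, hd, hxd⟩ : ∃ d : ℕ, 0 < d ∧ N * y = x + d :=
      have hlt : x < N * y := by
        have := Nat.le_mul_of_pos_right N hy
        omega
      ⟨N * y - x, by omega, by omega⟩
    obtain ⟨n, hn⟩ := h (d * (N + 1))
    have hdvd : ((N + d * (N + 1) * y + 1 : ℕ) : ℤ) ∣ ((d * (N + 1) : ℕ) : ℤ) := by
      refine ⟨y * n - (x : ℤ), ?_⟩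
      zify at hn hxd
      push_cast
      linear_combination -(y : ℤ) * hn - ((N : ℤ) + 1) * hxd
    have hle := Nat.le_of_dvd (by positivity) (Int.natCast_dvd_natCast.1 hdvd)
    nlinarith [Nat.le_mul_of_pos_right (d * (N + 1)) hy]

/-- Theorem notmcfg. -/
theorem stmt10 {T : Type} (a c : T) (hac : a ≠ c) :
    ¬ ∃ (m : ℕ) (G : PMCFG T), 1 ≤ m ∧ G.WF m ∧ G.NonDup ∧
      G.lang = {w | ∃ k n : ℕ,
        w = List.replicate n a ++ (List.replicate k (c :: List.replicate n a)).flatten} := by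
  rintro ⟨m, G, hm, hwf, hnd, hL⟩
  obtain ⟨B, hB⟩ := PMCFG.exists_parikh_pumping hm hwf hnd a c
  have hmem : List.replicate (B + 1) a ++
      (List.replicate (B + 1) (c :: List.replicate (B + 1) a)).flatten ∈ G.lang := by
    rw [hL]
    exact ⟨B + 1, B + 1, rfl⟩
  rcases hB _ hmem with hle | ⟨p, hp, hle, hpump⟩
  · rw [parikh_blocks hac] at hle
    simp only at hle
    omega
  · refine hp (eq_zero_of_pump_blocks (N := B + 1) (by omega) fun i => ?_)
    obtain ⟨w, hw, e⟩ := hpump i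
    rw [hL] at hw
    obtain ⟨k, n, rfl⟩ := hw
    rw [parikh_blocks hac, parikh_blocks hac] at e
    exact ⟨k, n, e⟩

end Rewbs
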